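/- Let I and J be finite sets, Q : I → J → I → J → ℝ, B, C ∈ ℝ, ĵ ∈ J, and Δ ∈ ℝ. Define the scaled matrix Q̃ by Q̃ i j u v = Q i j u v − Δ if j = ĵ and Q̃ i j u v = Q i j u v otherwise. Then for any two (B,C)-feasible solutions y, z : I → J → ℝ, the difference of objective values is preserved under scaling: f_Q(z) − f_Q(y) = f_{Q̃}(z) − f_{Q̃}(y). -/

import Mathlib

/-- A solution `x : I → J → ℝ` is `(B,C)`-feasible if every entry is in `{0,1}`,
every column sum (over `I`) equals `B`, and every row sum (over `J`) equals `C`. -/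
def IsFeasible {I J : Type*} [Fintype I] [Fintype J]
    (B C : ℝ) (x : I → J → ℝ) : Prop :=
  (∀ i j, x i j = 0 ∨ x i j = 1) ∧
  (∀ j, ∑ i, x i j = B) ∧
  (∀ i, ∑ j, x i j = C)

/-- The quadratic objective `f_Q(x) = ∑_{i,j,u,v} x i j * Q i j u v * x u v`. -/
def objective {I J : Type*} [Fintype I] [Fintype J]
    (Q : I → J → I → J → ℝ) (x : I → J → ℝ) : ℝ :=
  ∑ i : I, ∑ j : J, ∑ u : I, ∑ v : J, x i j * Q i j u v * x u v

/-- Scaling shifts the objective of a feasible solution by a constant. -/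
theorem objective_scaled {I J : Type*} [Fintype I] [Fintype J]
    [DecidableEq J]
    (Q : I → J → I → J → ℝ) (B C : ℝ) (jhat : J) (Δ : ℝ)
    (x : I → J → ℝ) (hx : IsFeasible B C x) :
    objective (fun i j u v => if j = jhat then Q i j u v - Δ else Q i j u v) x
      = objective Q x - B * (Δ * ((Fintype.card I : ℝ) * C)) := by
  obtain ⟨-, hB, hC⟩ := hx
  have h2 : ∑ i : I, ∑ j : J, ∑ u : I, ∑ v : J,
      x i j * (if j = jhat then Δ else 0) * x u v
      = B * (Δ * ((Fintype.card I : ℝ) * C)) := by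
    simp_rw [← Finset.mul_sum, hC]
    simp only [Finset.sum_const, Finset.card_univ, nsmul_eq_mul, mul_ite, ite_mul, mul_zero,
      zero_mul, Finset.sum_ite_eq', Finset.mem_univ, if_true]
    rw [← Finset.sum_mul, ← Finset.sum_mul, hB, mul_assoc]
  rw [← h2]
  unfold objective
  simp only [← Finset.sum_sub_distrib]
  refine Finset.sum_congr rfl fun i _ => Finset.sum_congr rfl fun j _ =>
    Finset.sum_congr rfl fun u _ => Finset.sum_congr rfl fun v _ => ?_
  split_ifs <;> ring

theorem scaling_preserves_differences {I J : Type*} [Fintype I] [Fintype J]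
    [DecidableEq J]
    (Q : I → J → I → J → ℝ) (B C : ℝ) (jhat : J) (Δ : ℝ)
    (y z : I → J → ℝ) (hy : IsFeasible B C y) (hz : IsFeasible B C z) :
    objective Q z - objective Q y
      = objective (fun i j u v => if j = jhat then Q i j u v - Δ else Q i j u v) z
        - objective (fun i j u v => if j = jhat then Q i j u v - Δ else Q i j u v) y := by
  rw [objective_scaled Q B C jhat Δ z hz, objective_scaled Q B C jhat Δ y hy]
  ring
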